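/- Let 0<q<1, let n≥1 be an integer, let x_1,…,x_n>0, let p_1,…,p_n≥0 with Σ_{k=1}^n p_k = 1, and let α, β be real numbers with 2α≤1≤β. Write S = Σ_{k=1}^n p_k x_k. Then Γ_q(S+β) / ∏_{k=1}^n Γ_q(x_k+β)^{p_k} ≤ [ ((1−q^S)/(1−q))^{S+β−α} / ∏_{k=1}^n ((1−q^{x_k})/(1−q))^{p_k(x_k+β−α)} ] · exp( [ Li₂(1−q^S) − Σ_{k=1}^n p_k Li₂(1−q^{x_k}) ] / log q ). -/

import Mathlib

/-- The `q`-gamma function for `0 < q < 1`: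
`Γ_q(x) = (1−q)^(1−x) ∏_{j=0}^∞ (1−q^(j+1))/(1−q^(j+x))`. -/
noncomputable def qGamma (q x : ℝ) : ℝ :=
  (1 - q) ^ (1 - x) * ∏' j : ℕ, (1 - q ^ (j + 1)) / (1 - q ^ ((j : ℝ) + x))

/-- The dilogarithm `Li₂(z) = −∫₀^z log(1−t)/t dt`. -/
noncomputable def dilog (z : ℝ) : ℝ := -∫ t in (0:ℝ)..z, Real.log (1 - t) / t

theorem one_sub_le_neg_log_mul {Q α β : ℝ} (hQ0 : 0 < Q) (hQ1 : Q < 1)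
    (hα : 2 * α ≤ 1) (hβ : 1 ≤ β) :
    1 - Q ≤ -Real.log Q * Q ^ β + (β - α) * -Real.log Q * (1 - Q) := by
  set t := -Real.log Q with ht
  have htpos : 0 < t := neg_pos.2 (Real.log_neg hQ0 hQ1)
  have hlog : 2 * (1 - Q) ≤ t * (1 + Q) := by
    have h := Real.le_log_one_add_of_nonneg (x := Q⁻¹ - 1)
      (sub_nonneg.2 ((one_le_inv₀ hQ0).2 hQ1.le))
    have h1 : 2 * (Q⁻¹ - 1) / (Q⁻¹ - 1 + 2) = 2 * (1 - Q) / (1 + Q) := by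
      have : Q⁻¹ - 1 + 2 = (1 + Q) / Q := by field_simp; ring
      rw [this]
      field_simp
    rw [h1, add_sub_cancel, Real.log_inv, ← ht, div_le_iff₀ (by linarith)] at h
    exact h
  have hQt : t * Q ≤ 1 - Q := by
    have h := Real.one_sub_inv_le_log_of_pos hQ0
    have h' : t ≤ Q⁻¹ - 1 := by linarith
    calc t * Q ≤ (Q⁻¹ - 1) * Q := by gcongr
      _ = 1 - Q := by field_simp
  have hpow : Q * (1 - (β - 1) * t) ≤ Q ^ β := by
    have h1 : Q ^ β = Q * Q ^ (β - 1) := by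
      rw [Real.rpow_sub_one hQ0.ne']
      field_simp
    have h2 := Real.add_one_le_exp (Real.log Q * (β - 1))
    rw [h1, Real.rpow_def_of_pos hQ0]
    gcongr
    linarith [show Real.log Q = -t by simp [ht]]
  nlinarith [mul_le_mul_of_nonneg_left hpow htpos.le,
    mul_nonneg (mul_nonneg (sub_nonneg.2 hβ) htpos.le) (sub_nonneg.2 hQt),
    mul_nonneg (mul_nonneg (show 0 ≤ 1 / 2 - α by linarith) htpos.le) (sub_nonneg.2 hQ1.le)]

theorem hasSum_neg_log_one_sub_rpow {q y : ℝ} (hq0 : 0 < q) (hq1 : q < 1) (hy : 0 < y) :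
    HasSum (fun m : ℕ => (q ^ (m + 1)) ^ y / ((m : ℝ) + 1)) (-Real.log (1 - q ^ y)) := by
  have h := Real.hasSum_pow_div_log_of_abs_lt_one (x := q ^ y) (by
    rw [abs_of_pos (by positivity)]
    exact Real.rpow_lt_one hq0.le hq1 hy)
  simpa only [Real.rpow_pow_comm hq0.le] using h

theorem summable_rpow_div_one_sub {q y : ℝ} (hq0 : 0 < q) (hq1 : q < 1) (hy : 0 < y) :
    Summable (fun m : ℕ => (q ^ (m + 1)) ^ y / (((m : ℝ) + 1) * (1 - q ^ (m + 1)))) := by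
  refine Summable.of_nonneg_of_le (fun m => ?_) (fun m => ?_)
    ((hasSum_neg_log_one_sub_rpow hq0 hq1 hy).summable.mul_right (1 - q)⁻¹)
  · have : q ^ (m + 1) < 1 := pow_lt_one₀ hq0.le hq1 (by simp)
    have : 0 < 1 - q ^ (m + 1) := by linarith
    positivity
  · have h : q ^ (m + 1) ≤ q := pow_le_of_le_one hq0.le hq1.le (by simp)
    have : 0 < 1 - q := by linarith
    rw [← div_eq_mul_inv, div_div]
    gcongr

theorem hasSum_neg_log_one_sub_rpow_add {q y : ℝ} (hq0 : 0 < q) (hq1 : q < 1) (hy : 0 < y) :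
    HasSum (fun j : ℕ => -Real.log (1 - q ^ ((j : ℝ) + y)))
      (∑' m : ℕ, (q ^ (m + 1)) ^ y / (((m : ℝ) + 1) * (1 - q ^ (m + 1)))) := by
  let f : ℕ × ℕ → ℝ := fun a => (q ^ (a.1 + 1)) ^ ((a.2 : ℝ) + y) / ((a.1 : ℝ) + 1)
  have hrow (m : ℕ) : HasSum (fun j => f (m, j))
      ((q ^ (m + 1)) ^ y / (((m : ℝ) + 1) * (1 - q ^ (m + 1)))) := by
    have hQ0 : 0 < q ^ (m + 1) := by positivity
    have h := (hasSum_geometric_of_lt_one hQ0.le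
      (pow_lt_one₀ hq0.le hq1 (by simp))).mul_left ((q ^ (m + 1)) ^ y / ((m : ℝ) + 1))
    rw [← div_eq_mul_inv, div_div] at h
    refine h.congr_fun fun j => ?_
    simp only [f]
    rw [Real.rpow_add hQ0, Real.rpow_natCast]
    ring
  have hf : Summable f := by
    refine (summable_prod_of_nonneg fun a => ?_).2 ⟨fun m => (hrow m).summable, ?_⟩
    · simp only [f, Pi.zero_apply]
      positivity
    · simpa only [(hrow _).tsum_eq] using summable_rpow_div_one_sub hq0 hq1 hy
  rw [(hf.hasSum.prod_fiberwise hrow).tsum_eq]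
  refine ((Equiv.prodComm ℕ ℕ).hasSum_iff.2 hf.hasSum).prod_fiberwise fun j => ?_
  exact hasSum_neg_log_one_sub_rpow hq0 hq1 (y := (j : ℝ) + y) (by positivity)

theorem qGamma_eq_exp {q y : ℝ} (hq0 : 0 < q) (hq1 : q < 1) (hy : 0 < y) :
    qGamma q y = Real.exp ((1 - y) * Real.log (1 - q)
      - ∑' m : ℕ, (q ^ (m + 1)) ^ (1 : ℝ) / (((m : ℝ) + 1) * (1 - q ^ (m + 1)))
      + ∑' m : ℕ, (q ^ (m + 1)) ^ y / (((m : ℝ) + 1) * (1 - q ^ (m + 1)))) := by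
  have hpos {z : ℝ} (hz : 0 < z) : 0 < 1 - q ^ z := sub_pos.2 (Real.rpow_lt_one hq0.le hq1 hz)
  have hterm (j : ℕ) : 1 - q ^ (j + 1) = 1 - q ^ ((j : ℝ) + 1) := by
    rw [← Real.rpow_natCast]
    push_cast
    rfl
  have hprod := Real.hasProd_of_hasSum_log
    (f := fun j : ℕ => (1 - q ^ (j + 1)) / (1 - q ^ ((j : ℝ) + y)))
    (fun j => by
      rw [hterm]
      exact div_pos (hpos (by positivity)) (hpos (by positivity)))
    (((hasSum_neg_log_one_sub_rpow_add hq0 hq1 hy).sub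
      (hasSum_neg_log_one_sub_rpow_add hq0 hq1 one_pos)).congr_fun fun j => by
        rw [hterm, Real.log_div (hpos (by positivity)).ne' (hpos (by positivity)).ne']
        ring)
  rw [qGamma, hprod.tprod_eq, Real.rpow_def_of_pos (by linarith), ← Real.exp_add]
  congr 1
  ring

theorem hasDerivAt_dilog {z : ℝ} (hz0 : 0 < z) (hz1 : z < 1) :
    HasDerivAt dilog (-(Real.log (1 - z) / z)) z := by
  have hmeas : Measurable fun t : ℝ => Real.log (1 - t) / t := by fun_prop
  refine (intervalIntegral.integral_hasDerivAt_right ?_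
    hmeas.stronglyMeasurable.stronglyMeasurableAtFilter ?_).neg
  · rw [intervalIntegrable_iff_integrableOn_Ioc_of_le hz0.le]
    refine MeasureTheory.IntegrableOn.of_bound (by simp) hmeas.aestronglyMeasurable (1 - z)⁻¹ ?_
    refine (MeasureTheory.ae_restrict_iff' measurableSet_Ioc).2 (.of_forall fun t ht => ?_)
    have h1t : 0 < 1 - t := by linarith [ht.2]
    have hlog := Real.one_sub_inv_le_log_of_pos h1t
    rw [Real.norm_eq_abs, abs_div, abs_of_pos ht.1, div_le_iff₀ ht.1,
      abs_of_nonpos (Real.log_nonpos h1t.le (by linarith [ht.1]))]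
    calc -Real.log (1 - t) ≤ (1 - t)⁻¹ - 1 := by linarith
      _ = (1 - t)⁻¹ * t := by field_simp; ring
      _ ≤ (1 - z)⁻¹ * t := by
        have := ht.1
        have := ht.2
        have : 0 < 1 - z := by linarith
        gcongr
  · exact ((continuousAt_const.sub continuousAt_id).log (sub_pos.2 hz1).ne').div
      continuousAt_id hz0.ne'

theorem summable_rpow_div_sq {q x : ℝ} (hq0 : 0 < q) (hq1 : q < 1) (hx : 0 < x) :
    Summable fun m : ℕ => (q ^ (m + 1)) ^ x / ((m : ℝ) + 1) ^ 2 := by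
  refine Summable.of_nonneg_of_le (fun m => by positivity) (fun m => ?_)
    (hasSum_neg_log_one_sub_rpow hq0 hq1 hx).summable
  gcongr
  nlinarith [(m.cast_nonneg : (0 : ℝ) ≤ m)]

theorem hasDerivAt_tsum_rpow_div_sq {q x : ℝ} (hq0 : 0 < q) (hq1 : q < 1) (hx : 0 < x) :
    HasDerivAt (fun y => ∑' m : ℕ, (q ^ (m + 1)) ^ y / ((m : ℝ) + 1) ^ 2)
      (-Real.log q * Real.log (1 - q ^ x)) x := by
  have hderiv := hasDerivAt_tsum_of_isPreconnected
    (g := fun (m : ℕ) y => (q ^ (m + 1)) ^ y / ((m : ℝ) + 1) ^ 2)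
    (g' := fun (m : ℕ) y => Real.log q * ((q ^ (m + 1)) ^ y / ((m : ℝ) + 1)))
    (t := Set.Ioi (x / 2)) (y₀ := x) (y := x)
    ((hasSum_neg_log_one_sub_rpow hq0 hq1 (half_pos hx)).summable.mul_left |Real.log q|)
    isOpen_Ioi isPreconnected_Ioi
    (fun m y _ => by
      refine ((Real.hasStrictDerivAt_const_rpow (a := q ^ (m + 1)) (by positivity)
        y).hasDerivAt.div_const _).congr_deriv ?_
      rw [Real.log_pow]
      push_cast
      field_simp)
    (fun m y hy => by
      have h : (q ^ (m + 1)) ^ y ≤ (q ^ (m + 1)) ^ (x / 2) :=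
        Real.rpow_le_rpow_of_exponent_ge (by positivity) (pow_le_one₀ hq0.le hq1.le)
          (Set.mem_Ioi.1 hy).le
      rw [norm_mul, Real.norm_eq_abs, Real.norm_of_nonneg (by positivity)]
      gcongr)
    (Set.mem_Ioi.2 (half_lt_self hx)) (summable_rpow_div_sq hq0 hq1 hx)
    (Set.mem_Ioi.2 (half_lt_self hx))
  rw [((hasSum_neg_log_one_sub_rpow hq0 hq1 hx).mul_left (Real.log q)).tsum_eq] at hderiv
  exact hderiv.congr_deriv (by ring)

/-- Euler's reflection formula for the dilogarithm, up to the value of the constant. -/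
theorem exists_dilog_one_sub_rpow_eq {q : ℝ} (hq0 : 0 < q) (hq1 : q < 1) :
    ∃ C : ℝ, ∀ x : ℝ, 0 < x → dilog (1 - q ^ x) =
      C - x * Real.log q * Real.log (1 - q ^ x)
        - ∑' m : ℕ, (q ^ (m + 1)) ^ x / ((m : ℝ) + 1) ^ 2 := by
  let F : ℝ → ℝ := fun x => dilog (1 - q ^ x) + x * (Real.log q * Real.log (1 - q ^ x))
    + ∑' m : ℕ, (q ^ (m + 1)) ^ x / ((m : ℝ) + 1) ^ 2
  have hF (x : ℝ) (hx : 0 < x) : HasDerivAt F 0 x := by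
    have hu0 : 0 < q ^ x := by positivity
    have hu1 : 0 < 1 - q ^ x := sub_pos.2 (Real.rpow_lt_one hq0.le hq1 hx)
    have hsub := ((Real.hasStrictDerivAt_const_rpow hq0 x).hasDerivAt).const_sub 1
    have hdi := (hasDerivAt_dilog hu1 (by linarith)).comp x hsub
    have hlog := (hasDerivAt_id x).mul ((hsub.log hu1.ne').const_mul (Real.log q))
    refine ((hdi.add hlog).add (hasDerivAt_tsum_rpow_div_sq hq0 hq1 hx)).congr_deriv ?_
    rw [sub_sub_cancel, Real.log_rpow hq0, id]
    field_simp
    ring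
  refine ⟨F 1, fun x hx => ?_⟩
  have h := isOpen_Ioi.is_const_of_deriv_eq_zero (isPreconnected_Ioi (a := (0 : ℝ)))
    (fun y hy => (hF y hy).differentiableAt.differentiableWithinAt)
    (fun y hy => (hF y hy).deriv) (Set.mem_Ioi.2 hx) (Set.mem_Ioi.2 one_pos)
  rw [← h]
  simp only [F]
  ring

/-- Up to an additive constant, the logarithm of the quotient of the two sides is a series of
exponentials with nonnegative coefficients. -/
theorem exists_hasSum_log_qGamma_sub {q α β : ℝ} (hq0 : 0 < q) (hq1 : q < 1)
    (hα : 2 * α ≤ 1) (hβ : 1 ≤ β) :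
    ∃ (K : ℝ) (d : ℕ → ℝ), (∀ m, 0 ≤ d m) ∧ ∀ x : ℝ, 0 < x →
      HasSum (fun m => d m * (q ^ (m + 1)) ^ x)
        (Real.log (qGamma q (x + β)) - (x + β - α) * Real.log ((1 - q ^ x) / (1 - q))
          - dilog (1 - q ^ x) / Real.log q - K) := by
  obtain ⟨C, hC⟩ := exists_dilog_one_sub_rpow_eq hq0 hq1
  have hL : Real.log q < 0 := Real.log_neg hq0 hq1
  have hL0 : Real.log q ≠ 0 := hL.ne
  refine ⟨(1 - α) * Real.log (1 - q)
      - ∑' m : ℕ, (q ^ (m + 1)) ^ (1 : ℝ) / (((m : ℝ) + 1) * (1 - q ^ (m + 1)))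
      - C / Real.log q,
    fun m => (q ^ (m + 1)) ^ β / (((m : ℝ) + 1) * (1 - q ^ (m + 1)))
      + (β - α) / ((m : ℝ) + 1) + (Real.log q)⁻¹ / ((m : ℝ) + 1) ^ 2, fun m => ?_, fun x hx => ?_⟩
  · have hQ1 : q ^ (m + 1) < 1 := pow_lt_one₀ hq0.le hq1 (by simp)
    have h := one_sub_le_neg_log_mul (by positivity) hQ1 hα hβ
    have hQ : 0 < 1 - q ^ (m + 1) := sub_pos.2 hQ1
    have hlog : Real.log (q ^ (m + 1)) = ((m : ℝ) + 1) * Real.log q := by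
      rw [Real.log_pow]
      push_cast
      rfl
    rw [hlog] at h
    have hL' : 0 < -Real.log q := neg_pos.2 hL
    have hrw : (q ^ (m + 1)) ^ β / (((m : ℝ) + 1) * (1 - q ^ (m + 1)))
        + (β - α) / ((m : ℝ) + 1) + (Real.log q)⁻¹ / ((m : ℝ) + 1) ^ 2
        = (-(((m : ℝ) + 1) * Real.log q) * (q ^ (m + 1)) ^ β
            + (β - α) * -(((m : ℝ) + 1) * Real.log q) * (1 - q ^ (m + 1)) - (1 - q ^ (m + 1)))
          / (((m : ℝ) + 1) ^ 2 * -Real.log q * (1 - q ^ (m + 1))) := by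
      field_simp
      ring
    simp only [hrw]
    exact div_nonneg (sub_nonneg.2 h) (by positivity)
  · have hu1 : 0 < 1 - q ^ x := sub_pos.2 (Real.rpow_lt_one hq0.le hq1 hx)
    have hsum := ((summable_rpow_div_one_sub hq0 hq1 (show 0 < x + β by linarith)).hasSum.add
      ((hasSum_neg_log_one_sub_rpow hq0 hq1 hx).mul_left (β - α))).add
      ((summable_rpow_div_sq hq0 hq1 hx).hasSum.mul_left (Real.log q)⁻¹)
    convert hsum using 1
    · ext m
      rw [Real.rpow_add (by positivity)]
      ring
    · rw [qGamma_eq_exp hq0 hq1 (by linarith), Real.log_exp, hC x hx,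
        Real.log_div hu1.ne' (by linarith)]
      field_simp
      ring

/-- Jensen-type inequality for the `q`-gamma function: for `0 < q < 1`, weights
`p k ≥ 0` summing to `1`, points `x k > 0`, and `2α ≤ 1 ≤ β`, with
`S = Σ p k * x k`,
`Γ_q(S+β) / ∏ Γ_q(x k+β)^(p k) ≤ [((1−q^S)/(1−q))^(S+β−α) / ∏ ((1−q^(x k))/(1−q))^(p k (x k+β−α))] · exp((Li₂(1−q^S) − Σ p k Li₂(1−q^(x k)))/log q)`. -/
theorem qGamma_jensen_ineq (q : ℝ) (hq0 : 0 < q) (hq1 : q < 1)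
    (n : ℕ) (hn : 1 ≤ n) (x p : Fin n → ℝ)
    (hx : ∀ k, 0 < x k) (hp : ∀ k, 0 ≤ p k) (hps : ∑ k, p k = 1)
    (α β : ℝ) (hα : 2 * α ≤ 1) (hβ : 1 ≤ β) :
    qGamma q ((∑ k, p k * x k) + β) / ∏ k, (qGamma q (x k + β)) ^ (p k) ≤
      (((1 - q ^ (∑ k, p k * x k)) / (1 - q)) ^ ((∑ k, p k * x k) + β - α) /
          ∏ k, ((1 - q ^ (x k)) / (1 - q)) ^ (p k * (x k + β - α))) *
        Real.exp ((dilog (1 - q ^ (∑ k, p k * x k)) - ∑ k, p k * dilog (1 - q ^ (x k))) /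
          Real.log q) := by
  obtain ⟨K, d, hd, hsum⟩ := exists_hasSum_log_qGamma_sub hq0 hq1 hα hβ
  set S := ∑ k, p k * x k with hS
  have hSpos : 0 < S := by
    obtain ⟨k, -, hk⟩ := Finset.exists_ne_zero_of_sum_ne_zero (hps.trans_ne one_ne_zero)
    exact Finset.sum_pos' (fun i _ => mul_nonneg (hp i) (hx i).le)
      ⟨k, Finset.mem_univ k, mul_pos ((hp k).lt_of_ne' hk) (hx k)⟩
  have hjensen := hasSum_le (fun m => by
      have h := (convexOn_rpow_left (b := q ^ (m + 1)) (by positivity)).map_sum_le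
        (t := Finset.univ) (w := p) (p := x) (fun i _ => hp i) hps (fun _ _ => Set.mem_univ _)
      simp only [smul_eq_mul] at h
      exact (mul_le_mul_of_nonneg_left h (hd m)).trans_eq (by
        rw [Finset.mul_sum]
        exact Finset.sum_congr rfl fun k _ => mul_left_comm _ _ _))
    (hsum S hSpos) (hasSum_sum fun k (_ : k ∈ Finset.univ) => (hsum (x k) (hx k)).mul_left (p k))
  have hΓ {y : ℝ} (hy : 0 < y) : 0 < qGamma q (y + β) := by
    rw [qGamma_eq_exp hq0 hq1 (by linarith)]
    exact Real.exp_pos _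
  have hu {y : ℝ} (hy : 0 < y) : 0 < (1 - q ^ y) / (1 - q) :=
    div_pos (sub_pos.2 (Real.rpow_lt_one hq0.le hq1 hy)) (by linarith)
  have hprod : ∏ k, qGamma q (x k + β) ^ p k
      = Real.exp (∑ k, p k * Real.log (qGamma q (x k + β))) := by
    rw [Real.exp_sum]
    refine Finset.prod_congr rfl fun k _ => ?_
    rw [Real.rpow_def_of_pos (hΓ (hx k)), mul_comm]
  have hprod' : ∏ k, ((1 - q ^ x k) / (1 - q)) ^ (p k * (x k + β - α))
      = Real.exp (∑ k, p k * ((x k + β - α) * Real.log ((1 - q ^ x k) / (1 - q)))) := by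
    rw [Real.exp_sum]
    refine Finset.prod_congr rfl fun k _ => ?_
    rw [Real.rpow_def_of_pos (hu (hx k))]
    congr 1
    ring
  rw [hprod, hprod', ← Real.exp_log (hΓ hSpos), Real.rpow_def_of_pos (hu hSpos),
    ← Real.exp_sub, ← Real.exp_sub, ← Real.exp_add, Real.exp_le_exp,
    sub_div (dilog _), Finset.sum_div]
  simp only [mul_sub, Finset.sum_sub_distrib, ← Finset.sum_mul, hps, one_mul,
    ← mul_div_assoc] at hjensen ⊢
  linarith
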